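/- Let m ≥ 1 be an integer and let C be a nonempty subset of {1,…,m}. Then the sum of (−1)^{#π−1}·(#π−1)! over all set partitions π of {1,…,m} into nonempty blocks that contain C as one of their blocks equals (−1)^{m−|C|}. -/

import Mathlib

/-- The set of all set partitions of a finite set `s` into nonempty blocks. -/
def partitionsOf {α : Type*} [DecidableEq α] (s : Finset α) : Finset (Finset (Finset α)) :=
  s.powerset.powerset.filter
    (fun π => (∀ B ∈ π, B ≠ ∅) ∧ (∀ B ∈ π, ∀ B' ∈ π, B ≠ B' → B ∩ B' = ∅) ∧
      π.sup id = s)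

section PartitionsOf

variable {α : Type*} [DecidableEq α]

theorem mem_partitionsOf {s : Finset α} {π : Finset (Finset α)} :
    π ∈ partitionsOf s ↔
      (∀ B ∈ π, B.Nonempty) ∧ (∀ B ∈ π, ∀ B' ∈ π, ∀ x ∈ B, x ∈ B' → B = B') ∧
        ∀ x, x ∈ s ↔ ∃ B ∈ π, x ∈ B := by
  have hsup : π.sup id = s ↔ ∀ x, x ∈ s ↔ ∃ B ∈ π, x ∈ B := by
    simp only [Finset.ext_iff, Finset.mem_sup, id]
    exact forall_congr' fun x => Iff.comm
  have hdisj : (∀ B ∈ π, ∀ B' ∈ π, B ≠ B' → B ∩ B' = ∅) ↔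
      ∀ B ∈ π, ∀ B' ∈ π, ∀ x ∈ B, x ∈ B' → B = B' := by
    refine forall₂_congr fun B _ => forall₂_congr fun B' _ => ?_
    simp only [Finset.eq_empty_iff_forall_notMem, Finset.mem_inter]
    exact ⟨fun h x hx hx' => by_contra fun hne => h hne x ⟨hx, hx'⟩,
      fun h hne x hx => hne (h x hx.1 hx.2)⟩
  simp only [partitionsOf, Finset.mem_filter, hsup, hdisj, Finset.mem_powerset,
    ← Finset.nonempty_iff_ne_empty]
  refine ⟨fun h => h.2, fun h => ⟨fun B hB => ?_, h⟩⟩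
  exact Finset.mem_powerset.2 fun x hx => (h.2.2 x).2 ⟨B, hB, hx⟩

theorem erase_mem_partitionsOf {s C : Finset α} {π : Finset (Finset α)}
    (hπ : π ∈ partitionsOf s) (hC : C ∈ π) : π.erase C ∈ partitionsOf (s \ C) := by
  rw [mem_partitionsOf] at hπ ⊢
  obtain ⟨h₁, h₂, h₃⟩ := hπ
  refine ⟨fun B hB => h₁ B (Finset.mem_of_mem_erase hB), fun B hB B' hB' =>
    h₂ B (Finset.mem_of_mem_erase hB) B' (Finset.mem_of_mem_erase hB'), fun x => ?_⟩
  simp only [Finset.mem_sdiff, Finset.mem_erase, h₃]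
  constructor
  · rintro ⟨⟨B, hB, hx⟩, hxC⟩
    exact ⟨B, ⟨fun h => hxC (h ▸ hx), hB⟩, hx⟩
  · rintro ⟨B, ⟨hne, hB⟩, hx⟩
    exact ⟨⟨B, hB, hx⟩, fun hxC => hne (h₂ B hB C hC x hx hxC)⟩

theorem notMem_of_mem_partitionsOf_sdiff {s C : Finset α} {σ : Finset (Finset α)}
    (hC : C.Nonempty) (hσ : σ ∈ partitionsOf (s \ C)) : C ∉ σ := fun h => by
  obtain ⟨x, hx⟩ := hC
  have := ((mem_partitionsOf.1 hσ).2.2 x).2 ⟨C, h, hx⟩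
  exact (Finset.mem_sdiff.1 this).2 hx

theorem insert_mem_partitionsOf {s C : Finset α} {σ : Finset (Finset α)}
    (hC : C.Nonempty) (hCs : C ⊆ s) (hσ : σ ∈ partitionsOf (s \ C)) :
    insert C σ ∈ partitionsOf s := by
  rw [mem_partitionsOf] at hσ ⊢
  obtain ⟨h₁, h₂, h₃⟩ := hσ
  simp only [Finset.mem_sdiff] at h₃
  have hdisj : ∀ B ∈ σ, ∀ x ∈ B, x ∉ C := fun B hB x hx => ((h₃ x).2 ⟨B, hB, hx⟩).2
  refine ⟨?_, ?_, fun x => ?_⟩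
  · simpa [hC] using h₁
  · intro B hB B' hB' x hx hx'
    rw [Finset.mem_insert] at hB hB'
    rcases hB with rfl | hB <;> rcases hB' with rfl | hB'
    · rfl
    · exact absurd hx (hdisj B' hB' x hx')
    · exact absurd hx' (hdisj B hB x hx)
    · exact h₂ B hB B' hB' x hx hx'
  · rw [Finset.exists_mem_insert, ← h₃]
    have := @hCs x
    tauto

theorem sum_partitionsOf_filter_mem {M : Type*} [AddCommMonoid M] {s C : Finset α}
    (hC : C.Nonempty) (hCs : C ⊆ s) (f : ℕ → M) :
    ∑ π ∈ (partitionsOf s).filter (fun π => C ∈ π), f π.card =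
      ∑ σ ∈ partitionsOf (s \ C), f (σ.card + 1) := by
  refine Finset.sum_bij' (fun π _ => π.erase C) (fun σ _ => insert C σ) ?_ ?_ ?_ ?_ ?_
  · intro π hπ
    rw [Finset.mem_filter] at hπ
    exact erase_mem_partitionsOf hπ.1 hπ.2
  · intro σ hσ
    exact Finset.mem_filter.2
      ⟨insert_mem_partitionsOf hC hCs hσ, Finset.mem_insert_self C σ⟩
  · intro π hπ
    exact Finset.insert_erase (Finset.mem_filter.1 hπ).2
  · intro σ hσ
    exact Finset.erase_insert (notMem_of_mem_partitionsOf_sdiff hC hσ)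
  · intro π hπ
    rw [Finset.card_erase_add_one (Finset.mem_filter.1 hπ).2]

theorem partitionsOf_empty : partitionsOf (∅ : Finset α) = {∅} := by
  ext π
  rw [mem_partitionsOf, Finset.mem_singleton]
  constructor
  · rintro ⟨h₁, -, h₃⟩
    refine Finset.eq_empty_of_forall_notMem fun B hB => ?_
    obtain ⟨x, hx⟩ := h₁ B hB
    exact Finset.notMem_empty x ((h₃ x).2 ⟨B, hB, hx⟩)
  · rintro rfl
    simp

/-- Summing over pairs of a partition and one of its blocks. -/
theorem sum_partitionsOf_card_smul {M : Type*} [AddCommMonoid M] (s : Finset α) (f : ℕ → M) :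
    ∑ π ∈ partitionsOf s, π.card • f π.card =
      ∑ C ∈ s.powerset.erase ∅, ∑ σ ∈ partitionsOf (s \ C), f (σ.card + 1) := by
  have hcomm : ∑ π ∈ partitionsOf s, ∑ _C ∈ π, f π.card =
      ∑ C ∈ s.powerset.erase ∅,
        ∑ π ∈ (partitionsOf s).filter (fun π => C ∈ π), f π.card := by
    refine Finset.sum_comm' fun π C => ?_
    rw [Finset.mem_filter, Finset.mem_erase, Finset.mem_powerset,
      ← Finset.nonempty_iff_ne_empty]
    refine ⟨fun ⟨hπ, hC⟩ => ⟨⟨hπ, hC⟩, ?_⟩, fun h => h.1⟩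
    obtain ⟨h₁, -, h₃⟩ := mem_partitionsOf.1 hπ
    exact ⟨h₁ C hC, fun x hx => (h₃ x).2 ⟨C, hC, hx⟩⟩
  simp only [Finset.sum_const] at hcomm
  rw [hcomm]
  refine Finset.sum_congr rfl fun C hC => ?_
  rw [Finset.mem_erase, Finset.mem_powerset, ← Finset.nonempty_iff_ne_empty] at hC
  exact sum_partitionsOf_filter_mem hC.1 hC.2 f

theorem sum_partitionsOf_neg_one_pow_mul_factorial (s : Finset α) :
    ∑ π ∈ partitionsOf s, (-1 : ℤ) ^ π.card * π.card.factorial = (-1) ^ s.card := by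
  induction s using Finset.strongInduction with
  | H s ih =>
  rcases s.eq_empty_or_nonempty with rfl | hs
  · simp [partitionsOf_empty]
  have hterm : ∀ π ∈ partitionsOf s, (-1 : ℤ) ^ π.card * π.card.factorial =
      π.card • ((-1 : ℤ) ^ π.card * (π.card - 1).factorial) := by
    intro π hπ
    obtain ⟨x, hx⟩ := hs
    obtain ⟨B, hB, -⟩ := ((mem_partitionsOf.1 hπ).2.2 x).1 hx
    rw [← Nat.mul_factorial_pred (Finset.card_ne_zero_of_mem hB), nsmul_eq_mul]
    push_cast
    ring
  rw [Finset.sum_congr rfl hterm,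
    sum_partitionsOf_card_smul s fun k => (-1 : ℤ) ^ k * (k - 1).factorial]
  have hinner : ∀ C ∈ s.powerset.erase ∅,
      ∑ σ ∈ partitionsOf (s \ C),
        (-1 : ℤ) ^ (σ.card + 1) * (σ.card + 1 - 1).factorial =
      -(-1) ^ s.card * (-1) ^ C.card := by
    intro C hC
    rw [Finset.mem_erase, Finset.mem_powerset, ← Finset.nonempty_iff_ne_empty] at hC
    have h := ih (s \ C) (Finset.sdiff_ssubset hC.2 hC.1)
    have hcard := Finset.card_sdiff_add_card_eq_card hC.2
    simp only [Nat.add_sub_cancel, pow_succ, mul_neg_one, neg_mul, Finset.sum_neg_distrib, h]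
    rw [← hcard, pow_add, mul_assoc, ← mul_pow]
    simp
  rw [Finset.sum_congr rfl hinner, ← Finset.mul_sum]
  have hsum := Finset.sum_powerset_neg_one_pow_card_of_nonempty hs
  rw [← Finset.add_sum_erase _ _ (Finset.empty_mem_powerset s), Finset.card_empty,
    pow_zero] at hsum
  rw [eq_neg_of_add_eq_zero_right hsum]
  ring

end PartitionsOf

/-- for a nonempty subset `C` of `{1,…,m}`, the sum of
`(−1)^{#π−1}(#π−1)!` over all set partitions `π` of `{1,…,m}` containing `C` as a
block equals `(−1)^{m−|C|}`. -/
theorem sum_mobius_over_partitions_with_block (m : ℕ) (hm : 1 ≤ m)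
    (C : Finset (Fin m)) (hC : C.Nonempty) :
    ∑ π ∈ (partitionsOf (Finset.univ : Finset (Fin m))).filter (fun π => C ∈ π),
      (-1 : ℤ) ^ (π.card - 1) * (π.card - 1).factorial = (-1 : ℤ) ^ (m - C.card) := by
  rw [sum_partitionsOf_filter_mem hC (Finset.subset_univ C)
    fun k => (-1 : ℤ) ^ (k - 1) * (k - 1).factorial]
  simp only [Nat.add_sub_cancel]
  rw [sum_partitionsOf_neg_one_pow_mul_factorial,
    Finset.card_sdiff_of_subset (Finset.subset_univ C), Finset.card_univ, Fintype.card_fin]
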